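/- arXiv:1707.03732 — 2 statements merged into one kernel-verified Lean document; each statement's English description precedes it below -/
import Mathlib

section
/- For each i ≥ 1 there is a short exact sequence of left R-modules 0 → M_i → U_{R,a} → U_{R,a} → 0, where the first map is the canonical map ψ_i; that is, there exists a surjective R-module endomorphism φ_i : U_{R,a} → U_{R,a} whose kernel is exactly Im(ψ_i). In particular U_{R,a}/ψ_i(M_i) ≅ U_{R,a}, so every proper quotient of U_{R,a} by one of the submodules Im(ψ_i) is isomorphic to U_{R,a}. -/
/-- The transition map `ψ_{i,ℓ} : R/Ra^i → R/Ra^ℓ`, `r + Ra^i ↦ r·a^{ℓ-i} + Ra^ℓ`. -/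
def psi {R : Type*} [Ring R] (a : R) (i ℓ : ℕ) (h : i ≤ ℓ) :
    (R ⧸ Submodule.span R {a ^ i}) →ₗ[R] (R ⧸ Submodule.span R {a ^ ℓ}) :=
  Submodule.liftQ _
    ((Submodule.span R {a ^ ℓ}).mkQ ∘ₗ LinearMap.toSpanSingleton R R (a ^ (ℓ - i)))
    (by
      rw [Submodule.span_le]
      rintro x hx
      rw [Set.mem_singleton_iff] at hx
      subst hx
      simp only [SetLike.mem_coe, LinearMap.mem_ker, LinearMap.comp_apply,
        LinearMap.toSpanSingleton_apply, Submodule.mkQ_apply,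
        Submodule.Quotient.mk_eq_zero, smul_eq_mul]
      rw [← pow_add, Nat.add_sub_cancel' h]
      exact Submodule.mem_span_singleton_self _)

/-- The `a`-Prüfer module `U_{R,a}`: the direct limit of the system `{M_i, ψ_{i,j}}_{1 ≤ i ≤ j}`,
realized as the direct limit over `n : ℕ` of `M_{n+1} = R/R·a^{n+1}`. -/
noncomputable abbrev pruefer (R : Type*) [Ring R] (a : R) : Type _ :=
  Module.DirectLimit (fun n : ℕ => R ⧸ Submodule.span R {a ^ (n + 1)})
    (fun i j h => psi a (i + 1) (j + 1) (Nat.succ_le_succ h))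

noncomputable instance pruefer.hasQuotient (R : Type*) [Ring R] (a : R) :
    HasQuotient (pruefer R a) (Submodule R (pruefer R a)) :=
  @Submodule.hasQuotient R (pruefer R a) _ (Module.DirectLimit.addCommGroup _ _) (Module.DirectLimit.module _ _)

noncomputable instance pruefer.quotientAddCommGroup (R : Type*) [Ring R] (a : R)
    (N : Submodule R (pruefer R a)) : AddCommGroup (pruefer R a ⧸ N) :=
  @Submodule.Quotient.addCommGroup R (pruefer R a) _ (Module.DirectLimit.addCommGroup _ _) (Module.DirectLimit.module _ _) N

noncomputable instance pruefer.quotientModule (R : Type*) [Ring R] (a : R)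
    (N : Submodule R (pruefer R a)) : Module R (pruefer R a ⧸ N) :=
  @Submodule.Quotient.module R (pruefer R a) _ (Module.DirectLimit.addCommGroup _ _) (Module.DirectLimit.module _ _) N

/-- A surjective linear map with kernel `N` identifies its codomain with the quotient by `N`. -/
noncomputable def quotEquivOfKerEq {R M P : Type*} [Ring R] [AddCommGroup M] [AddCommGroup P]
    [Module R M] [Module R P] {f : M →ₗ[R] P} (hf : Function.Surjective f) {N : Submodule R M}
    (hN : LinearMap.ker f = N) : (M ⧸ N) ≃ₗ[R] P :=
  (Submodule.quotEquivOfEq _ _ hN.symm).trans (f.quotKerEquivOfSurjective hf)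

namespace pruefer

variable {R : Type*} [Ring R] (a : R)

theorem psi_mk (i l : ℕ) (h : i ≤ l) (r : R) :
    psi a i l h (Submodule.Quotient.mk r) = Submodule.Quotient.mk (r * a ^ (l - i)) :=
  rfl

instance directedSystem :
    DirectedSystem (fun n : ℕ => R ⧸ Submodule.span R {a ^ (n + 1)})
      (fun i j h => psi a (i + 1) (j + 1) (Nat.succ_le_succ h)) where
  map_self i x := by
    obtain ⟨r, rfl⟩ := Submodule.Quotient.mk_surjective _ x
    simp [psi_mk]
  map_map {k j i} hij hjk x := by
    obtain ⟨r, rfl⟩ := Submodule.Quotient.mk_surjective _ x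
    rw [psi_mk, psi_mk, psi_mk, mul_assoc, ← pow_add]
    congr 3
    omega

/-- The canonical map from `R/Ra^{n+1}` to the `a`-Prüfer module. -/
noncomputable abbrev of (n : ℕ) : (R ⧸ Submodule.span R {a ^ (n + 1)}) →ₗ[R] pruefer R a :=
  Module.DirectLimit.of R ℕ (fun n : ℕ => R ⧸ Submodule.span R {a ^ (n + 1)})
    (fun i j h => psi a (i + 1) (j + 1) (Nat.succ_le_succ h)) n

theorem of_add_mk (n k : ℕ) (r : R) :
    of a (n + k) (Submodule.Quotient.mk (r * a ^ k)) = of a n (Submodule.Quotient.mk r) := by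
  have h := Module.DirectLimit.of_f (R := R)
    (f := fun i j h => psi a (i + 1) (j + 1) (Nat.succ_le_succ h))
    (hij := Nat.le_add_right n k) (x := Submodule.Quotient.mk r)
  rwa [psi_mk, show n + k + 1 - (n + 1) = k by omega] at h

theorem exists_of_mk (z : pruefer R a) :
    ∃ (n : ℕ) (r : R), of a n (Submodule.Quotient.mk r) = z := by
  obtain ⟨n, x, hx⟩ := Module.DirectLimit.exists_of z
  obtain ⟨r, rfl⟩ := Submodule.Quotient.mk_surjective _ x
  exact ⟨n, r, hx⟩

variable {a}

theorem psi_injective (ha : IsRightRegular a) (i l : ℕ) (h : i ≤ l) :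
    Function.Injective (psi a i l h) := by
  rw [injective_iff_map_eq_zero]
  intro x hx
  obtain ⟨r, rfl⟩ := Submodule.Quotient.mk_surjective _ x
  rw [psi_mk, Submodule.Quotient.mk_eq_zero, Submodule.mem_span_singleton] at hx
  obtain ⟨s, hs⟩ := hx
  rw [Submodule.Quotient.mk_eq_zero, Submodule.mem_span_singleton]
  refine ⟨s, ha.pow (l - i) ?_⟩
  simpa [mul_assoc, ← pow_add, Nat.add_sub_cancel' h] using hs

theorem of_injective (ha : IsRightRegular a) (n : ℕ) : Function.Injective (of a n) := by
  intro x y hxy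
  obtain ⟨j, hj, h⟩ := Module.DirectLimit.exists_eq_of_of_eq hxy
  exact psi_injective ha _ _ _ h

variable (a)

/-- Right multiplication by `a ^ k` on the `a`-Prüfer module. -/
noncomputable def mulPow (k : ℕ) : pruefer R a →ₗ[R] pruefer R a :=
  Module.DirectLimit.map
    (fun n => Submodule.mapQ _ _ (LinearMap.toSpanSingleton R R (a ^ k)) (by
      rw [Submodule.span_le, Set.singleton_subset_iff]
      exact Submodule.mem_span_singleton.2 ⟨a ^ k, by
        simpa using (pow_mul_comm a k (n + 1))⟩))
    (fun i j h => by
      ext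
      change Submodule.Quotient.mk (1 * a ^ (j + 1 - (i + 1)) * a ^ k) =
        Submodule.Quotient.mk (1 * a ^ k * a ^ (j + 1 - (i + 1)))
      rw [mul_assoc, mul_assoc, pow_mul_comm])

theorem mulPow_of_mk (k n : ℕ) (r : R) :
    mulPow a k (of a n (Submodule.Quotient.mk r)) = of a n (Submodule.Quotient.mk (r * a ^ k)) :=
  Module.DirectLimit.map_apply_of _ _ _

theorem mulPow_surjective (k : ℕ) : Function.Surjective (mulPow a k) := by
  intro z
  obtain ⟨n, r, rfl⟩ := exists_of_mk a z
  exact ⟨of a (n + k) (Submodule.Quotient.mk r), by rw [mulPow_of_mk, of_add_mk]⟩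

variable {a}

theorem ker_mulPow_succ (ha : IsRightRegular a) (i : ℕ) :
    LinearMap.ker (mulPow a (i + 1)) = LinearMap.range (of a i) := by
  ext z
  rw [LinearMap.mem_ker, LinearMap.mem_range]
  constructor
  · intro hz
    obtain ⟨n, r, rfl⟩ := exists_of_mk a z
    rw [mulPow_of_mk, ← of_add_mk a n i, map_eq_zero_iff _ (of_injective ha _),
      Submodule.Quotient.mk_eq_zero, Submodule.mem_span_singleton] at hz
    obtain ⟨s, hs⟩ := hz
    refine ⟨Submodule.Quotient.mk s, ?_⟩
    have hr : s * a ^ n = r * a ^ i := by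
      apply ha.pow (i + 1)
      simpa [mul_assoc, ← pow_add, add_assoc, add_comm, add_left_comm] using hs
    rw [← of_add_mk a i n, ← of_add_mk a n i, hr, add_comm i n]
  · rintro ⟨x, rfl⟩
    obtain ⟨s, rfl⟩ := Submodule.Quotient.mk_surjective _ x
    rw [mulPow_of_mk, (Submodule.Quotient.mk_eq_zero _).2
      (Submodule.mem_span_singleton.2 ⟨s, smul_eq_mul s (a ^ (i + 1))⟩), map_zero]

/-- The quotient of the `a`-Prüfer module by the image of `R/Ra^{i+1}` is again the `a`-Prüfer
module. -/
noncomputable def quotRangeOfEquiv (ha : IsRightRegular a) (i : ℕ) :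
    (pruefer R a ⧸ LinearMap.range (of a i)) ≃ₗ[R] pruefer R a :=
  @quotEquivOfKerEq R (pruefer R a) (pruefer R a) _ (Module.DirectLimit.addCommGroup _ _)
    (Module.DirectLimit.addCommGroup _ _) (Module.DirectLimit.module _ _)
    (Module.DirectLimit.module _ _) (mulPow a (i + 1)) (mulPow_surjective a (i + 1)) (LinearMap.range (of a i))
    (ker_mulPow_succ ha i)

end pruefer

/-- For each `i ≥ 1` there is a short exact sequence of left `R`-modules
`0 → M_i → U_{R,a} → U_{R,a} → 0` where the first map is the canonical map `ψ_i`; that is,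
`ψ_i` is injective and there exists a surjective `R`-module endomorphism
`φ_i : U_{R,a} → U_{R,a}` whose kernel is exactly `Im(ψ_i)`. In particular
`U_{R,a}/ψ_i(M_i) ≅ U_{R,a}`. (Here the canonical map `ψ_{i+1} : M_{i+1} → U_{R,a}` is
indexed by `i : ℕ`.) -/
theorem stmt_7 {R : Type*} [Ring R] [Nontrivial R] (a : R)
    (h1 : ∀ r : R, r * a = 0 → r = 0)
    (h2 : Submodule.span R {a} ≠ (⊤ : Submodule R R)) :
    ∀ i : ℕ,
      Function.Injective
        (Module.DirectLimit.of R ℕ (fun n : ℕ => R ⧸ Submodule.span R {a ^ (n + 1)})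
          (fun i j h => psi a (i + 1) (j + 1) (Nat.succ_le_succ h)) i) ∧
      (∃ φ : pruefer R a →ₗ[R] pruefer R a,
        Function.Surjective φ ∧
        LinearMap.ker φ = LinearMap.range
          (Module.DirectLimit.of R ℕ (fun n : ℕ => R ⧸ Submodule.span R {a ^ (n + 1)})
            (fun i j h => psi a (i + 1) (j + 1) (Nat.succ_le_succ h)) i)) ∧
      Nonempty
        ((pruefer R a ⧸ LinearMap.range
            (Module.DirectLimit.of R ℕ (fun n : ℕ => R ⧸ Submodule.span R {a ^ (n + 1)})
              (fun i j h => psi a (i + 1) (j + 1) (Nat.succ_le_succ h)) i))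
          ≃ₗ[R] pruefer R a) := by
  intro i
  have ha : IsRightRegular a := isRightRegular_iff_left_eq_zero_of_mul.2 h1
  refine ⟨pruefer.of_injective ha i, ⟨pruefer.mulPow a (i + 1), pruefer.mulPow_surjective a _,
    pruefer.ker_mulPow_succ ha i⟩, ⟨pruefer.quotRangeOfEquiv ha i⟩⟩
end

section
/- Let ψ₁ : K[x,x⁻¹]/((x−1)) → U be the canonical map of the first module of the direct system into the Prüfer module U. Then the image ψ₁(K[x,x⁻¹]/((x−1))) is a simple submodule of U, and it is essential: every nonzero submodule of U contains it. Consequently (combined with the injectivity of U), U is the injective envelope of the simple module K[x,x⁻¹]/((x−1)). -/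
/-- The Prüfer module `U` over `K[x,x⁻¹]`: the direct limit of the modules
`M_n = K[x,x⁻¹]/((x−1)^n)`, `n ≥ 1`, with transition maps sending `r + ((x−1)^i)` to
`r(x−1)^{ℓ−i} + ((x−1)^ℓ)`, realized as the direct limit over `n : ℕ` of `M_{n+1}`.
(Here `x = T 1`.) -/
noncomputable abbrev laurentPruefer (K : Type*) [Field K] : Type _ :=
  Module.DirectLimit
    (fun n : ℕ => LaurentPolynomial K ⧸
      Submodule.span (LaurentPolynomial K) {(LaurentPolynomial.T 1 - 1) ^ (n + 1)})
    (fun i j h => psi (LaurentPolynomial.T 1 - 1) (i + 1) (j + 1) (Nat.succ_le_succ h))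

section PrueferSystem

variable {R : Type*} [CommRing R] (a : R)

theorem psi_mk (i ℓ : ℕ) (h : i ≤ ℓ) (r : R) :
    psi a i ℓ h (Submodule.Quotient.mk r) = Submodule.Quotient.mk (r * a ^ (ℓ - i)) :=
  rfl

theorem psi_injective (ha : a ∈ nonZeroDivisors R) (i ℓ : ℕ) (h : i ≤ ℓ) :
    Function.Injective (psi a i ℓ h) := by
  rw [injective_iff_map_eq_zero]
  intro x hx
  obtain ⟨r, rfl⟩ := Submodule.Quotient.mk_surjective _ x
  rw [psi_mk, Submodule.Quotient.mk_eq_zero, Submodule.mem_span_singleton] at hx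
  obtain ⟨s, hs⟩ := hx
  rw [Submodule.Quotient.mk_eq_zero, Submodule.mem_span_singleton]
  refine ⟨s, (mul_cancel_right_mem_nonZeroDivisors (pow_mem ha (ℓ - i))).1 ?_⟩
  rw [← hs, smul_eq_mul, smul_eq_mul, mul_assoc, ← pow_add, Nat.add_sub_cancel' h]

instance directedSystem_psi :
    DirectedSystem (fun n : ℕ => R ⧸ Submodule.span R {a ^ (n + 1)})
      (fun i j h => psi a (i + 1) (j + 1) (Nat.succ_le_succ h)) where
  map_self i x := by
    obtain ⟨r, rfl⟩ := Submodule.Quotient.mk_surjective _ x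
    rw [psi_mk, Nat.sub_self, pow_zero, mul_one]
  map_map k j i hij hjk x := by
    obtain ⟨r, rfl⟩ := Submodule.Quotient.mk_surjective _ x
    rw [psi_mk, psi_mk, psi_mk, mul_assoc, ← pow_add]
    congr 3
    omega

/-- The canonical map of `R/(a^(n+1))` into the direct limit of the system `psi a`. -/
noncomputable abbrev prueferOf (n : ℕ) :
    (R ⧸ Submodule.span R {a ^ (n + 1)}) →ₗ[R]
      Module.DirectLimit (fun n : ℕ => R ⧸ Submodule.span R {a ^ (n + 1)})
        (fun i j h => psi a (i + 1) (j + 1) (Nat.succ_le_succ h)) :=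
  Module.DirectLimit.of R ℕ (fun n : ℕ => R ⧸ Submodule.span R {a ^ (n + 1)})
    (fun i j h => psi a (i + 1) (j + 1) (Nat.succ_le_succ h)) n

theorem prueferOf_mk_mul_pow (i j : ℕ) (h : i ≤ j) (r : R) :
    prueferOf a j (Submodule.Quotient.mk (r * a ^ (j - i))) =
      prueferOf a i (Submodule.Quotient.mk r) := by
  rw [← Nat.add_sub_add_right j 1 i, ← psi_mk a (i + 1) (j + 1) (Nat.succ_le_succ h)]
  exact Module.DirectLimit.of_f (hij := h)

theorem prueferOf_injective (ha : a ∈ nonZeroDivisors R) (n : ℕ) :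
    Function.Injective (prueferOf a n) := by
  rw [injective_iff_map_eq_zero]
  intro x hx
  obtain ⟨j, hj, h⟩ := Module.DirectLimit.of.zero_exact hx
  exact (injective_iff_map_eq_zero _).1 (psi_injective a ha _ _ _) x h

/-- Every nonzero element of the direct limit has a nonzero multiple in the image of `R/(a)`. -/
theorem exists_smul_prueferOf_mem_range (ha : a ∈ nonZeroDivisors R) (n : ℕ) (r : R)
    (h : prueferOf a n (Submodule.Quotient.mk r) ≠ 0) :
    ∃ s : R, s • prueferOf a n (Submodule.Quotient.mk r) ≠ 0 ∧
      s • prueferOf a n (Submodule.Quotient.mk r) ∈ LinearMap.range (prueferOf a 0) := by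
  induction n with
  | zero => exact ⟨1, by rwa [one_smul], by rw [one_smul]; exact ⟨_, rfl⟩⟩
  | succ n ih =>
    have key : a • prueferOf a (n + 1) (Submodule.Quotient.mk r) =
        prueferOf a n (Submodule.Quotient.mk r) := by
      rw [← prueferOf_mk_mul_pow a n (n + 1) n.le_succ r, ← map_smul,
        ← Submodule.Quotient.mk_smul, smul_eq_mul, Nat.add_sub_cancel_left, pow_one, mul_comm]
    by_cases h0 : prueferOf a n (Submodule.Quotient.mk r) = 0
    · have hr := (injective_iff_map_eq_zero _).1 (prueferOf_injective a ha n) _ h0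
      rw [Submodule.Quotient.mk_eq_zero, Submodule.mem_span_singleton] at hr
      obtain ⟨t, rfl⟩ := hr
      refine ⟨1, by rwa [one_smul], Submodule.Quotient.mk t, ?_⟩
      rw [one_smul, ← prueferOf_mk_mul_pow a 0 (n + 1) (Nat.zero_le _) t]
      rfl
    · obtain ⟨s, hs, hs'⟩ := ih h0
      refine ⟨s * a, ?_, ?_⟩
      · rwa [mul_smul, key]
      · rwa [mul_smul, key]

theorem isSimpleModule_range_prueferOf_zero (ha : a ∈ nonZeroDivisors R)
    (hmax : (Ideal.span {a}).IsMaximal) :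
    IsSimpleModule R (LinearMap.range (prueferOf a 0)) := by
  have : IsSimpleModule R (R ⧸ Submodule.span R {a ^ (0 + 1)}) := by
    rw [isSimpleModule_iff_isCoatom, zero_add, pow_one]
    exact hmax.out
  exact IsSimpleModule.congr (LinearEquiv.ofInjective _ (prueferOf_injective a ha 0)).symm

theorem range_prueferOf_zero_le (ha : a ∈ nonZeroDivisors R)
    (hmax : (Ideal.span {a}).IsMaximal)
    (N : Submodule R (Module.DirectLimit (fun n : ℕ => R ⧸ Submodule.span R {a ^ (n + 1)})
      (fun i j h => psi a (i + 1) (j + 1) (Nat.succ_le_succ h)))) (hN : N ≠ ⊥) :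
    LinearMap.range (prueferOf a 0) ≤ N := by
  have hatom := isSimpleModule_iff_isAtom.1 (isSimpleModule_range_prueferOf_zero a ha hmax)
  obtain ⟨u, hu, hu0⟩ := N.ne_bot_iff.1 hN
  obtain ⟨n, x, rfl⟩ := Module.DirectLimit.exists_of u
  obtain ⟨r, rfl⟩ := Submodule.Quotient.mk_surjective _ x
  obtain ⟨s, hs0, hs⟩ := exists_smul_prueferOf_mem_range a ha n r hu0
  refine (hatom.not_disjoint_iff_le).1 fun hdis => hs0 ?_
  exact Submodule.disjoint_def.1 hdis _ hs (N.smul_mem s hu)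

end PrueferSystem

namespace LaurentPolynomial

theorem T_sub_one_mem_span {R : Type*} [CommRing R] (n : ℤ) :
    (T n - 1 : LaurentPolynomial R) ∈ Ideal.span {(T 1 - 1 : LaurentPolynomial R)} := by
  rw [← Ideal.Quotient.eq]
  have h1 : Ideal.Quotient.mk (Ideal.span {(T 1 - 1 : LaurentPolynomial R)}) (T 1) = 1 := by
    rw [← map_one (Ideal.Quotient.mk _), Ideal.Quotient.eq]
    exact Ideal.mem_span_singleton_self _
  rw [map_one]
  induction n with
  | zero => rw [T_zero, map_one]
  | succ n ih => rw [T_add, map_mul, ih, h1, one_mul]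
  | pred n ih => rw [← ih, ← sub_add_cancel (-(n : ℤ)) 1, T_add, map_mul, h1, mul_one,
      sub_add_cancel]

theorem sub_C_eval₂_one_mem_span {R : Type*} [CommRing R] (f : LaurentPolynomial R) :
    f - C (eval₂ (RingHom.id R) 1 f) ∈ Ideal.span {(T 1 - 1 : LaurentPolynomial R)} := by
  induction f using LaurentPolynomial.induction_on' with
  | add p q hp hq =>
    rw [map_add, map_add, add_sub_add_comm]
    exact add_mem hp hq
  | C_mul_T n r =>
    rw [eval₂_C_mul_T, one_zpow, Units.val_one, mul_one, RingHom.id_apply, ← mul_sub_one]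
    exact Ideal.mul_mem_left _ _ (T_sub_one_mem_span n)

theorem span_T_one_sub_one_eq_ker {R : Type*} [CommRing R] :
    Ideal.span {(T 1 - 1 : LaurentPolynomial R)} =
      RingHom.ker (eval₂ (RingHom.id R) (1 : Rˣ)) := by
  refine le_antisymm ?_ fun f hf => ?_
  · rw [Ideal.span_singleton_le_iff_mem, RingHom.mem_ker, map_sub, eval₂_T, map_one]
    simp
  · have := sub_C_eval₂_one_mem_span f
    rwa [RingHom.mem_ker.1 hf, map_zero, sub_zero] at this

theorem isMaximal_span_T_one_sub_one {K : Type*} [Field K] :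
    (Ideal.span {(T 1 - 1 : LaurentPolynomial K)}).IsMaximal := by
  rw [span_T_one_sub_one_eq_ker]
  exact RingHom.ker_isMaximal_of_surjective _ fun k => ⟨C k, by simp⟩

theorem T_one_sub_one_mem_nonZeroDivisors {K : Type*} [Field K] :
    (T 1 - 1 : LaurentPolynomial K) ∈ nonZeroDivisors (LaurentPolynomial K) := by
  refine mem_nonZeroDivisors_of_ne_zero (sub_ne_zero.2 fun h => ?_)
  rw [← T_zero] at h
  have hdeg := congrArg degree h
  rw [degree_T, degree_T] at hdeg
  exact one_ne_zero (WithBot.coe_injective hdeg)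

end LaurentPolynomial

/-- Let `ψ₁ : K[x,x⁻¹]/((x−1)) → U` be the canonical map of the first module of
the direct system into the Prüfer module `U`. Then the image `ψ₁(K[x,x⁻¹]/((x−1)))` is a
simple submodule of `U`, and it is essential: every nonzero submodule of `U` contains it.
(Consequently, combined with the injectivity of `U`, `U` is the injective envelope of the
simple module `K[x,x⁻¹]/((x−1))`.) -/
theorem stmt_17 {K : Type*} [Field K] :
    @IsSimpleModule (LaurentPolynomial K) _
      (LinearMap.range
        (Module.DirectLimit.of (LaurentPolynomial K) ℕ
          (fun n : ℕ => LaurentPolynomial K ⧸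
            Submodule.span (LaurentPolynomial K) {(LaurentPolynomial.T 1 - 1) ^ (n + 1)})
          (fun i j h => psi (LaurentPolynomial.T 1 - 1) (i + 1) (j + 1) (Nat.succ_le_succ h))
          0))
      (@Submodule.addCommGroup _ _ _ (Module.DirectLimit.addCommGroup _ _) _ _)
      (Submodule.module _) ∧
    ∀ N : Submodule (LaurentPolynomial K) (laurentPruefer K), N ≠ ⊥ →
      LinearMap.range
        (Module.DirectLimit.of (LaurentPolynomial K) ℕ
          (fun n : ℕ => LaurentPolynomial K ⧸
            Submodule.span (LaurentPolynomial K) {(LaurentPolynomial.T 1 - 1) ^ (n + 1)})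
          (fun i j h => psi (LaurentPolynomial.T 1 - 1) (i + 1) (j + 1) (Nat.succ_le_succ h))
          0) ≤ N := by
  exact ⟨isSimpleModule_range_prueferOf_zero _ LaurentPolynomial.T_one_sub_one_mem_nonZeroDivisors
      LaurentPolynomial.isMaximal_span_T_one_sub_one,
    range_prueferOf_zero_le _ LaurentPolynomial.T_one_sub_one_mem_nonZeroDivisors
      LaurentPolynomial.isMaximal_span_T_one_sub_one⟩
end
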